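/- Characterization of c₀ by closed measures: −c₀ = min over closed Borel probability measures μ on X × X (i.e., π₁_*μ = π₂_*μ) of ∫ c dμ; moreover any closed probability measure supported on the 2-Aubry set realizes the minimum, and a closed measure realizes the minimum only if it is supported where u₀(y) − u₀(x) = c(x,y) + c₀ for a strict continuous subsolution u₀. -/

import Mathlib

open MeasureTheory

/-- The (negative) Lax–Oleinik operator. -/
noncomputable def Tminus {X : Type*} (c : X × X → ℝ) (f : X → ℝ) : X → ℝ :=
  fun x => ⨅ y, (f y + c (y, x))

open Filter Topology

/-- The uniform probability measure on the first `n + 1` terms of a sequence. -/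
noncomputable def empiricalMeasure {Z : Type*} [MeasurableSpace Z] (z : ℕ → Z) (n : ℕ) :
    Measure Z :=
  ((n : ENNReal) + 1)⁻¹ • ∑ k ∈ Finset.range (n + 1), Measure.dirac (z k)

instance isProbabilityMeasure_empiricalMeasure {Z : Type*} [MeasurableSpace Z] (z : ℕ → Z)
    (n : ℕ) : IsProbabilityMeasure (empiricalMeasure z n) := by
  constructor
  have h : ((n : ENNReal) + 1) ≠ ⊤ := by simp
  simp [empiricalMeasure, ENNReal.inv_mul_cancel _ h]

theorem integral_empiricalMeasure {Z : Type*} [TopologicalSpace Z] [MeasurableSpace Z]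
    [OpensMeasurableSpace Z] (z : ℕ → Z) (n : ℕ) {f : Z → ℝ} (hf : Continuous f) :
    ∫ p, f p ∂(empiricalMeasure z n) =
      ((n : ℝ) + 1)⁻¹ * ∑ k ∈ Finset.range (n + 1), f (z k) := by
  have hm := hf.stronglyMeasurable
  rw [empiricalMeasure, integral_smul_measure, integral_finsetSum_measure]
  · have h : (((n : ENNReal) + 1)⁻¹).toReal = ((n : ℝ) + 1)⁻¹ := by
      rw [ENNReal.toReal_inv, ENNReal.toReal_add (by simp) (by simp)]
      simp
    simp [integral_dirac' _ _ hm, h]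
  · intro k _
    exact integrable_dirac' hm (by simp)

/-- Empirical averages over any sequence in a compact metrizable space have a common
accumulation point which is a probability measure. -/
theorem exists_isProbabilityMeasure_tendsto_average {Z : Type*} [MetricSpace Z] [CompactSpace Z]
    [MeasurableSpace Z] [BorelSpace Z] (z : ℕ → Z) :
    ∃ (U : Ultrafilter ℕ) (μ : Measure Z), (U : Filter ℕ) ≤ atTop ∧ IsProbabilityMeasure μ ∧
      ∀ f : Z → ℝ, Continuous f →
        Tendsto (fun n : ℕ => ((n : ℝ) + 1)⁻¹ * ∑ k ∈ Finset.range (n + 1), f (z k)) U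
          (𝓝 (∫ p, f p ∂μ)) := by
  let ν : ℕ → ProbabilityMeasure Z := fun n => ⟨empiricalMeasure z n, inferInstance⟩
  let U : Ultrafilter ℕ := hyperfilter ℕ
  obtain ⟨μ, -, hμ⟩ := isCompact_univ.ultrafilter_le_nhds (U.map ν) (by simp)
  refine ⟨U, μ, Nat.hyperfilter_le_atTop, inferInstance, fun f hf => ?_⟩
  have h := ProbabilityMeasure.tendsto_iff_forall_integral_tendsto.1
    (show Tendsto ν U (𝓝 μ) from hμ) (BoundedContinuousFunction.mkOfCompact ⟨f, hf⟩)
  refine h.congr fun n => ?_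
  exact integral_empiricalMeasure z n hf

theorem integral_comp_fst_eq_integral_comp_snd {X : Type*} [TopologicalSpace X]
    [MeasurableSpace X] [OpensMeasurableSpace X] {μ : Measure (X × X)}
    (h : μ.map Prod.fst = μ.map Prod.snd) {f : X → ℝ} (hf : Continuous f) :
    ∫ p, f p.1 ∂μ = ∫ p, f p.2 ∂μ := by
  rw [← integral_map measurable_fst.aemeasurable hf.stronglyMeasurable.aestronglyMeasurable, h,
    integral_map measurable_snd.aemeasurable hf.stronglyMeasurable.aestronglyMeasurable]

/-- The backward edges `(x (k + 1), x k)` of a sequence generate a closed probability measure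
whose integral of a cost `c` is at most the linear growth rate of the accumulated cost. -/
theorem exists_closed_integral_le {X : Type*} [MetricSpace X] [CompactSpace X]
    [MeasurableSpace X] [BorelSpace X] {c : X × X → ℝ} (hc : Continuous c) (x : ℕ → X)
    (a B : ℝ) (hB : ∀ n : ℕ, ∑ k ∈ Finset.range n, c (x (k + 1), x k) ≤ n * a + B) :
    ∃ μ : Measure (X × X), IsProbabilityMeasure μ ∧ μ.map Prod.fst = μ.map Prod.snd ∧
      ∫ p, c p ∂μ ≤ a := by
  obtain ⟨U, μ, hU, hμ, hlim⟩ :=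
    exists_isProbabilityMeasure_tendsto_average (fun k => (x (k + 1), x k))
  have hinv (C : ℝ) : Tendsto (fun n : ℕ => ((n : ℝ) + 1)⁻¹ * C) U (𝓝 0) := by
    have h := (tendsto_one_div_add_atTop_nhds_zero_nat (𝕜 := ℝ)).mul_const C
    simp only [one_div, zero_mul] at h
    exact h.mono_left hU
  refine ⟨μ, hμ, ?_, ?_⟩
  · have : IsProbabilityMeasure (μ.map Prod.fst) :=
      Measure.isProbabilityMeasure_map measurable_fst.aemeasurable
    have : IsProbabilityMeasure (μ.map Prod.snd) :=
      Measure.isProbabilityMeasure_map measurable_snd.aemeasurable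
    refine ext_of_forall_integral_eq_of_IsFiniteMeasure fun f => ?_
    have hf := f.continuous
    rw [integral_map measurable_fst.aemeasurable hf.stronglyMeasurable.aestronglyMeasurable,
      integral_map measurable_snd.aemeasurable hf.stronglyMeasurable.aestronglyMeasurable]
    refine sub_eq_zero.1 (tendsto_nhds_unique
      ((hlim _ (hf.comp continuous_fst)).sub (hlim _ (hf.comp continuous_snd))) ?_)
    refine squeeze_zero_norm (fun n => ?_) (hinv (2 * ‖f‖))
    have hn : (0 : ℝ) ≤ ((n : ℝ) + 1)⁻¹ := by positivity
    simp only [Function.comp_apply]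
    rw [← mul_sub, ← Finset.sum_sub_distrib, Finset.sum_range_sub (fun k => f (x k)), norm_mul,
      Real.norm_of_nonneg hn, ← dist_eq_norm]
    exact mul_le_mul_of_nonneg_left (f.dist_le_two_norm _ _) hn
  · have h := (hinv B).const_add a
    rw [add_zero] at h
    refine le_of_tendsto_of_tendsto' (hlim c hc) h fun n => ?_
    have hn : (0 : ℝ) < (n : ℝ) + 1 := by positivity
    have := mul_le_mul_of_nonneg_left (hB (n + 1)) (inv_nonneg.2 hn.le)
    push_cast at this
    rwa [mul_add, inv_mul_cancel_left₀ hn.ne'] at this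

/-- A bounded weak KAM solution admits almost calibrated backward chains, along which the
accumulated cost grows at rate `-c₀`. -/
theorem exists_sum_cost_le_of_eq_Tminus {X : Type*} [Nonempty X] {c : X × X → ℝ} {c₀ : ℝ}
    {w : X → ℝ} {M : ℝ} (hM : ∀ x, |w x| ≤ M) (hw : ∀ x, w x = Tminus c w x + c₀) :
    ∃ x : ℕ → X, ∀ n : ℕ,
      ∑ k ∈ Finset.range n, c (x (k + 1), x k) ≤ n * (-c₀) + (2 * M + 2) := by
  have hstep (k : ℕ) (x : X) : ∃ y, w y + c (y, x) < w x - c₀ + (1 / 2) ^ k := by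
    refine exists_lt_of_ciInf_lt ?_
    have h := hw x
    have hk : (0 : ℝ) < (1 / 2) ^ k := by positivity
    unfold Tminus at h
    linarith
  choose g hg using hstep
  let x : ℕ → X := fun n => Nat.rec (Classical.arbitrary X) g n
  refine ⟨x, fun n => ?_⟩
  have hterm (k : ℕ) : c (x (k + 1), x k) ≤ (w (x k) - w (x (k + 1))) + -c₀ + (1 / 2) ^ k := by
    have h : w (x (k + 1)) + c (x (k + 1), x k) < w (x k) - c₀ + (1 / 2) ^ k := hg k (x k)
    linarith
  have hsum := Finset.sum_le_sum fun k (_ : k ∈ Finset.range n) => hterm k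
  rw [Finset.sum_add_distrib, Finset.sum_add_distrib,
    Finset.sum_range_sub' (fun k => w (x k)), Finset.sum_const, Finset.card_range,
    nsmul_eq_mul] at hsum
  have hgeom := sum_geometric_two_le n
  have h₁ := (abs_le.1 (hM (x 0))).2
  have h₂ := (abs_le.1 (hM (x n))).1
  linarith

/-- The defect of a continuous subsolution integrates, against a closed probability measure, to
the integral of the cost plus the critical constant. -/
theorem integral_defect_eq {X : Type*} [MetricSpace X] [CompactSpace X]
    [MeasurableSpace X] [BorelSpace X] {c : X × X → ℝ} (hc : Continuous c) (c₀ : ℝ)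
    {u : X → ℝ} (hu : Continuous u) (μ : Measure (X × X)) [IsProbabilityMeasure μ]
    (h : μ.map Prod.fst = μ.map Prod.snd) :
    ∫ p, (c p + c₀ - (u p.2 - u p.1)) ∂μ = ∫ p, c p ∂μ + c₀ := by
  have hint {f : X × X → ℝ} (hf : Continuous f) : Integrable f μ :=
    hf.integrable_of_hasCompactSupport (HasCompactSupport.of_compactSpace f)
  have h₁ : Integrable (fun p : X × X => u p.1) μ := hint (by fun_prop)
  have h₂ : Integrable (fun p : X × X => u p.2) μ := hint (by fun_prop)
  have h₃ : Integrable (fun p : X × X => c p + c₀) μ := hint (by fun_prop)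
  have h₄ : Integrable (fun p : X × X => u p.2 - u p.1) μ := hint (by fun_prop)
  rw [integral_sub h₃ h₄, integral_add (hint hc) (integrable_const c₀), integral_sub h₂ h₁,
    integral_comp_fst_eq_integral_comp_snd h hu]
  simp

theorem stmt17 {X : Type*} [MetricSpace X] [CompactSpace X] [Nonempty X]
    [MeasurableSpace X] [BorelSpace X]
    (c : X × X → ℝ) (hc : Continuous c) (c₀ : ℝ)
    (hcrit : ∃ w : X → ℝ, (∃ M, ∀ x, |w x| ≤ M) ∧ ∀ x, w x = Tminus c w x + c₀)
    (u₀ : X → ℝ) (hu₀_cont : Continuous u₀)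
    (hu₀ : ∀ x y : X, u₀ y - u₀ x ≤ c (x, y) + c₀)
    (hAne : {p : X × X | u₀ p.2 - u₀ p.1 = c p + c₀}.Nonempty) :
    IsLeast {r : ℝ | ∃ μ : Measure (X × X), IsProbabilityMeasure μ ∧
        μ.map Prod.fst = μ.map Prod.snd ∧ r = ∫ p, c p ∂μ} (-c₀) ∧
    (∀ μ : Measure (X × X), IsProbabilityMeasure μ →
        μ.map Prod.fst = μ.map Prod.snd →
        μ {p : X × X | u₀ p.2 - u₀ p.1 = c p + c₀}ᶜ = 0 →
        ∫ p, c p ∂μ = -c₀) ∧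
    (∀ μ : Measure (X × X), IsProbabilityMeasure μ →
        μ.map Prod.fst = μ.map Prod.snd →
        (∫ p, c p ∂μ) = -c₀ →
        μ {p : X × X | u₀ p.2 - u₀ p.1 = c p + c₀}ᶜ = 0) := by
  have hnn : ∀ p : X × X, 0 ≤ c p + c₀ - (u₀ p.2 - u₀ p.1) := fun p =>
    sub_nonneg.2 (hu₀ p.1 p.2)
  have hcont : Continuous fun p : X × X => c p + c₀ - (u₀ p.2 - u₀ p.1) := by fun_prop
  have hmin : ∀ μ : Measure (X × X), IsProbabilityMeasure μ →
      μ.map Prod.fst = μ.map Prod.snd → -c₀ ≤ ∫ p, c p ∂μ := by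
    intro μ _ h
    have h₁ := integral_defect_eq hc c₀ hu₀_cont μ h
    have h₂ : 0 ≤ ∫ p, (c p + c₀ - (u₀ p.2 - u₀ p.1)) ∂μ := integral_nonneg hnn
    linarith
  have hzero : ∀ μ : Measure (X × X), IsProbabilityMeasure μ →
      μ.map Prod.fst = μ.map Prod.snd →
      (∫ p, c p ∂μ = -c₀ ↔ μ {p : X × X | u₀ p.2 - u₀ p.1 = c p + c₀}ᶜ = 0) := by
    intro μ _ h
    have h₁ := integral_defect_eq hc c₀ hu₀_cont μ h
    have h₂ := integral_eq_zero_iff_of_nonneg (μ := μ) hnn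
      (hcont.integrable_of_hasCompactSupport (HasCompactSupport.of_compactSpace _))
    rw [h₁] at h₂
    rw [← add_eq_zero_iff_eq_neg, h₂]
    change (∀ᵐ p ∂μ, c p + c₀ - (u₀ p.2 - u₀ p.1) = 0) ↔
      ∀ᵐ p ∂μ, u₀ p.2 - u₀ p.1 = c p + c₀
    simp only [sub_eq_zero, eq_comm]
  refine ⟨⟨?_, ?_⟩, fun μ hμ h => (hzero μ hμ h).2, fun μ hμ h => (hzero μ hμ h).1⟩
  · obtain ⟨w, ⟨M, hM⟩, hw⟩ := hcrit
    obtain ⟨x, hx⟩ := exists_sum_cost_le_of_eq_Tminus hM hw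
    obtain ⟨μ, hμ, hclosed, hle⟩ := exists_closed_integral_le hc x (-c₀) (2 * M + 2) hx
    exact ⟨μ, hμ, hclosed, (hmin μ hμ hclosed).antisymm hle⟩
  · rintro r ⟨μ, hμ, h, rfl⟩
    exact hmin μ hμ h
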